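/- Let n ≥ 3. The set of pairs (V, u), where V : ℝⁿ → ℝⁿ is a smooth vector field and u : ℝⁿ → ℝ is a smooth function such that the operator f ↦ Σ_a V^a ∂_a f + u f maps every harmonic function on ℝⁿ to a harmonic function, is a real vector subspace of the space of such pairs, and its dimension equals (n² + 3n + 4)/2. -/

import Mathlib

/-- Partial derivative in the `a`-th coordinate direction. -/
noncomputable def pd {n : ℕ} (a : Fin n) (f : (Fin n → ℝ) → ℝ) : (Fin n → ℝ) → ℝ :=
  fun x => fderiv ℝ f x (Pi.single a (1 : ℝ))

/-- The Laplacian `Δf = Σ_a ∂_a ∂_a f`. -/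
noncomputable def lap {n : ℕ} (f : (Fin n → ℝ) → ℝ) : (Fin n → ℝ) → ℝ :=
  fun x => ∑ a, pd a (pd a f) x

section PartialDerivatives

variable {n : ℕ} {f g : (Fin n → ℝ) → ℝ}

theorem contDiff_pd (hf : ContDiff ℝ (⊤ : ℕ∞) f) (a : Fin n) :
    ContDiff ℝ (⊤ : ℕ∞) (pd a f) :=
  (hf.fderiv_right (m := (⊤ : ℕ∞)) (by simp)).clm_apply contDiff_const

theorem differentiable_of_smooth (hf : ContDiff ℝ (⊤ : ℕ∞) f) : Differentiable ℝ f :=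
  hf.differentiable (by simp)

theorem pd_comm (hf : ContDiff ℝ (⊤ : ℕ∞) f) (a b : Fin n) : pd a (pd b f) = pd b (pd a f) := by
  have key : ∀ (a b : Fin n) (x : Fin n → ℝ), pd a (pd b f) x =
      fderiv ℝ (fderiv ℝ f) x (Pi.single a 1) (Pi.single b 1) := by
    intro a b x
    have hd : DifferentiableAt ℝ (fderiv ℝ f) x :=
      ((hf.fderiv_right (m := (⊤ : ℕ∞)) (by simp)).differentiable (by simp)) x
    unfold pd
    rw [fderiv_clm_apply hd (differentiableAt_const _)]
    simp
  funext x
  rw [key, key]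
  refine (hf.contDiffAt.isSymmSndFDerivAt ?_) _ _
  rw [minSmoothness_of_isRCLikeNormedField]
  exact WithTop.coe_le_coe.2 le_top

theorem pd_const (a : Fin n) (c : ℝ) : pd a (fun _ => c) = fun _ => 0 := by
  funext x; simp [pd]

theorem pd_coord (a b : Fin n) : pd a (fun x => x b) = fun _ => if b = a then 1 else 0 := by
  funext x
  have : fderiv ℝ (fun x : Fin n → ℝ => x b) x = ContinuousLinearMap.proj b :=
    (ContinuousLinearMap.proj (R := ℝ) (φ := fun _ : Fin n => ℝ) b).fderiv
  simp [pd, this, Pi.single_apply]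

theorem pd_add (hf : Differentiable ℝ f) (hg : Differentiable ℝ g) (a : Fin n) :
    pd a (fun x => f x + g x) = fun x => pd a f x + pd a g x := by
  funext x; simp [pd, fderiv_fun_add (hf x) (hg x)]

theorem pd_sub (hf : Differentiable ℝ f) (hg : Differentiable ℝ g) (a : Fin n) :
    pd a (fun x => f x - g x) = fun x => pd a f x - pd a g x := by
  funext x; simp [pd, fderiv_fun_sub (hf x) (hg x)]

theorem pd_mul (hf : Differentiable ℝ f) (hg : Differentiable ℝ g) (a : Fin n) :
    pd a (fun x => f x * g x) = fun x => pd a f x * g x + f x * pd a g x := by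
  funext x; simp [pd, fderiv_fun_mul (hf x) (hg x)]; ring

theorem pd_const_mul (hf : Differentiable ℝ f) (c : ℝ) (a : Fin n) :
    pd a (fun x => c * f x) = fun x => c * pd a f x := by
  rw [pd_mul (by fun_prop) hf, pd_const]; simp

theorem pd_sum {ι : Type*} (s : Finset ι) {F : ι → (Fin n → ℝ) → ℝ}
    (hF : ∀ i, Differentiable ℝ (F i)) (a : Fin n) :
    pd a (fun x => ∑ i ∈ s, F i x) = fun x => ∑ i ∈ s, pd a (F i) x := by
  funext x; simp [pd, fderiv_fun_sum (fun i _ => hF i x)]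

theorem eq_const_of_pd_eq_zero (hf : Differentiable ℝ f) (h : ∀ a x, pd a f x = 0)
    (x : Fin n → ℝ) : f x = f 0 := by
  refine is_const_of_fderiv_eq_zero hf (fun y => ?_) x 0
  apply ContinuousLinearMap.coe_injective
  refine (Pi.basisFun ℝ (Fin n)).ext fun a => ?_
  simpa [pd] using h a y

theorem lap_add (hf : ContDiff ℝ (⊤ : ℕ∞) f) (hg : ContDiff ℝ (⊤ : ℕ∞) g) (x : Fin n → ℝ) :
    lap (fun x => f x + g x) x = lap f x + lap g x := by
  simp only [lap, ← Finset.sum_add_distrib]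
  refine Finset.sum_congr rfl fun a _ => ?_
  rw [pd_add (differentiable_of_smooth hf) (differentiable_of_smooth hg),
    pd_add (differentiable_of_smooth (contDiff_pd hf a))
      (differentiable_of_smooth (contDiff_pd hg a))]

theorem lap_sum {ι : Type*} (s : Finset ι) {F : ι → (Fin n → ℝ) → ℝ}
    (hF : ∀ i, ContDiff ℝ (⊤ : ℕ∞) (F i)) (x : Fin n → ℝ) :
    lap (fun x => ∑ i ∈ s, F i x) x = ∑ i ∈ s, lap (F i) x := by
  simp only [lap]
  rw [Finset.sum_comm]
  refine Finset.sum_congr rfl fun a _ => ?_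
  rw [pd_sum s fun i => differentiable_of_smooth (hF i),
    pd_sum s fun i => differentiable_of_smooth (contDiff_pd (hF i) a)]

theorem lap_mul (hf : ContDiff ℝ (⊤ : ℕ∞) f) (hg : ContDiff ℝ (⊤ : ℕ∞) g) (x : Fin n → ℝ) :
    lap (fun x => f x * g x) x =
      lap f x * g x + 2 * ∑ b, pd b f x * pd b g x + f x * lap g x := by
  have df := differentiable_of_smooth hf
  have dg := differentiable_of_smooth hg
  have dpf := fun a => differentiable_of_smooth (contDiff_pd hf a)
  have dpg := fun a => differentiable_of_smooth (contDiff_pd hg a)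
  simp only [lap, Finset.mul_sum, Finset.sum_mul, ← Finset.sum_add_distrib]
  refine Finset.sum_congr rfl fun a _ => ?_
  rw [pd_mul df dg, pd_add ((dpf a).fun_mul dg) (df.fun_mul (dpg a)), pd_mul (dpf a) dg,
    pd_mul df (dpg a)]
  ring

theorem lap_pd (hf : ContDiff ℝ (⊤ : ℕ∞) f) (a : Fin n) : lap (pd a f) = pd a (lap f) := by
  unfold lap
  rw [pd_sum _ fun b => differentiable_of_smooth (contDiff_pd (contDiff_pd hf b) b)]
  funext x
  refine Finset.sum_congr rfl fun b _ => ?_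
  rw [pd_comm (contDiff_pd hf b) a b, pd_comm hf a b]

/-- Action of the Laplacian on `Σ_a V^a ∂_a f + u f` for harmonic `f`. -/
theorem lap_firstOrder {V : (Fin n → ℝ) → Fin n → ℝ} {u : (Fin n → ℝ) → ℝ}
    (hV : ∀ a, ContDiff ℝ (⊤ : ℕ∞) fun x => V x a) (hu : ContDiff ℝ (⊤ : ℕ∞) u)
    (hf : ContDiff ℝ (⊤ : ℕ∞) f) (h : lap f = 0) (x : Fin n → ℝ) :
    lap (fun x => (∑ a, V x a * pd a f x) + u x * f x) x =
      lap u x * f x + (∑ a, (lap (fun x => V x a) x + 2 * pd a u x) * pd a f x) +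
        2 * ∑ a, ∑ b, pd b (fun x => V x a) x * pd b (pd a f) x := by
  have hp := contDiff_pd hf
  have h0 : ∀ a, lap (pd a f) x = 0 := fun a => by
    rw [lap_pd hf, h]; exact congrFun (pd_const a 0) x
  rw [lap_add (ContDiff.sum fun a _ => (hV a).mul (hp a)) (hu.mul hf),
    lap_sum _ fun a => (hV a).mul (hp a), lap_mul hu hf, h]
  simp only [lap_mul (hV _) (hp _), h0, add_mul, Finset.sum_add_distrib, Finset.mul_sum,
    Pi.zero_apply, mul_zero, add_zero, mul_assoc]
  ring

/-- The coefficients of a first-order operator preserving harmonicity satisfy the conformal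
Killing equation together with `ΔV^a = -2 ∂_a u` and `Δu = 0`. -/
structure ConformalSystem (V : (Fin n → ℝ) → Fin n → ℝ) (u : (Fin n → ℝ) → ℝ) : Prop where
  lap_zeroth : ∀ x, lap u x = 0
  lap_field : ∀ a x, lap (fun x => V x a) x + 2 * pd a u x = 0
  offDiag : ∀ a b, a ≠ b → ∀ x, pd a (fun x => V x b) x + pd b (fun x => V x a) x = 0
  diag : ∀ a b x, pd a (fun x => V x a) x = pd b (fun x => V x b) x

theorem ConformalSystem.preserves {V : (Fin n → ℝ) → Fin n → ℝ} {u : (Fin n → ℝ) → ℝ}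
    (hV : ∀ a, ContDiff ℝ (⊤ : ℕ∞) fun x => V x a) (hu : ContDiff ℝ (⊤ : ℕ∞) u)
    (hs : ConformalSystem V u) (hf : ContDiff ℝ (⊤ : ℕ∞) f) (h : lap f = 0) :
    lap (fun x => (∑ a, V x a * pd a f x) + u x * f x) = 0 := by
  funext x
  rw [lap_firstOrder hV hu hf h]
  simp only [hs.lap_zeroth, hs.lap_field, zero_mul, Finset.sum_const_zero, zero_add,
    Pi.zero_apply]
  have key : ∀ a b, pd b (fun x => V x a) x * pd b (pd a f) x +
      pd a (fun x => V x b) x * pd a (pd b f) x =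
      if a = b then 2 * (pd a (fun x => V x a) x * pd a (pd a f) x) else 0 := by
    intro a b
    split_ifs with hab
    · subst hab; ring
    · rw [pd_comm hf b a, ← add_mul, hs.offDiag b a (Ne.symm hab), zero_mul]
  have hsum : 2 * ∑ a, ∑ b, pd b (fun x => V x a) x * pd b (pd a f) x =
      ∑ a, 2 * (pd a (fun x => V x a) x * pd a (pd a f) x) := by
    rw [two_mul]
    nth_rewrite 2 [Finset.sum_comm]
    simp only [← Finset.sum_add_distrib, key, Finset.sum_ite_eq, Finset.mem_univ, if_true]
  rw [hsum]
  rcases isEmpty_or_nonempty (Fin n) with he | ⟨⟨o⟩⟩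
  · simp
  · have hl : ∑ a, pd a (pd a f) x = 0 := congrFun h x
    simp only [fun a => hs.diag a o x, ← Finset.mul_sum, hl, mul_zero]

theorem ConformalSystem.of_preserves {V : (Fin n → ℝ) → Fin n → ℝ} {u : (Fin n → ℝ) → ℝ}
    (hV : ∀ a, ContDiff ℝ (⊤ : ℕ∞) fun x => V x a) (hu : ContDiff ℝ (⊤ : ℕ∞) u)
    (H : ∀ f : (Fin n → ℝ) → ℝ, ContDiff ℝ (⊤ : ℕ∞) f → lap f = 0 →
      lap (fun x => (∑ a, V x a * pd a f x) + u x * f x) = 0) : ConformalSystem V u := by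
  have K : ∀ f : (Fin n → ℝ) → ℝ, ContDiff ℝ (⊤ : ℕ∞) f → lap f = 0 → ∀ x,
      lap u x * f x + (∑ a, (lap (fun x => V x a) x + 2 * pd a u x) * pd a f x) +
        2 * ∑ a, ∑ b, pd b (fun x => V x a) x * pd b (pd a f) x = 0 := fun f hf h x => by
    rw [← lap_firstOrder hV hu hf h, H f hf h]; rfl
  have h1 : ∀ x, lap u x = 0 := fun x => by
    simpa [pd_const] using K (fun _ => 1) contDiff_const (by funext x; simp [lap, pd_const]) x
  have h2 : ∀ a x, lap (fun x => V x a) x + 2 * pd a u x = 0 := fun c x => by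
    simpa [pd_const, pd_coord, h1] using
      K (fun x => x c) (by fun_prop) (by funext x; simp [lap, pd_const, pd_coord]) x
  have hd : ∀ c : Fin n, Differentiable ℝ (fun x : Fin n → ℝ => x c) := fun c => by fun_prop
  have hq : ∀ a b c d : Fin n, pd b (pd a fun x => x c * x d) = fun _ =>
      (if c = a then 1 else 0) * (if d = b then 1 else 0) +
      (if c = b then 1 else 0) * (if d = a then 1 else 0) := fun a b c d => by
    rw [pd_mul (hd c) (hd d), pd_add (by rw [pd_coord]; fun_prop) (by rw [pd_coord]; fun_prop)]
    simp only [pd_coord]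
    rw [pd_const_mul (hd d), pd_mul (hd c) (by fun_prop)]
    simp only [pd_coord, pd_const, mul_zero, add_zero]
  refine ⟨h1, h2, fun c d hcd x => ?_, fun c d x => ?_⟩
  · have := K (fun x => x c * x d) (by fun_prop) (by
      funext x; simp [lap, hq, hcd, Finset.sum_add_distrib]) x
    simp [h1, h2, hq, mul_add, Finset.sum_add_distrib] at this
    linarith
  · have hq' : ∀ a b : Fin n, pd b (pd a fun x => x c * x c - x d * x d) = fun x =>
        pd b (pd a fun x => x c * x c) x - pd b (pd a fun x => x d * x d) x := fun a b => by
      have hs : ∀ c, ContDiff ℝ (⊤ : ℕ∞) (fun x : Fin n → ℝ => x c * x c) := fun c => by fun_prop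
      rw [pd_sub (differentiable_of_smooth (hs c)) (differentiable_of_smooth (hs d)),
        pd_sub (differentiable_of_smooth (contDiff_pd (hs c) a))
          (differentiable_of_smooth (contDiff_pd (hs d) a))]
    have := K (fun x => x c * x c - x d * x d) (by fun_prop) (by
      funext x; simp [lap, hq', hq, Finset.sum_add_distrib]) x
    simp [h1, h2, hq', hq, mul_add, mul_sub, Finset.sum_add_distrib] at this
    linarith

theorem eq_of_pd_eq (hf : Differentiable ℝ f) (hg : Differentiable ℝ g)
    (h : ∀ a x, pd a f x = pd a g x) (h0 : f 0 = g 0) : f = g := by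
  funext x
  have := eq_const_of_pd_eq_zero (hf.fun_sub hg) (fun a x => by simp [pd_sub hf hg, h]) x
  simpa [h0, sub_eq_zero] using this

end PartialDerivatives

section ConformalKilling

variable {n : ℕ}

/-- The skew-symmetric matrix with prescribed strictly lower triangular entries. -/
def skewMatrix (μ : (Σ i : Fin n, Fin i) → ℝ) (a b : Fin n) : ℝ :=
  if h : b < a then μ ⟨a, ⟨b, h⟩⟩ else if h : a < b then -μ ⟨b, ⟨a, h⟩⟩ else 0

theorem skewMatrix_add_swap (μ : (Σ i : Fin n, Fin i) → ℝ) (a b : Fin n) :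
    skewMatrix μ a b + skewMatrix μ b a = 0 := by
  rcases lt_trichotomy a b with h | rfl | h
  · simp [skewMatrix, h, h.not_gt]
  · simp [skewMatrix]
  · simp [skewMatrix, h, h.not_gt]

theorem skewMatrix_self (μ : (Σ i : Fin n, Fin i) → ℝ) (a : Fin n) : skewMatrix μ a a = 0 := by
  simp [skewMatrix]

theorem skewMatrix_of_skew {m : Fin n → Fin n → ℝ} (hm : ∀ a b, m a b + m b a = 0) :
    skewMatrix (fun p : Σ i : Fin n, Fin i => m p.1 ⟨p.2, p.2.2.trans p.1.2⟩) = m := by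
  funext a b
  rcases lt_trichotomy a b with h | rfl | h
  · simp only [skewMatrix, h, h.not_gt, dif_pos, dif_neg, not_false_eq_true]
    linarith [hm a b]
  · simp only [skewMatrix, lt_irrefl, dif_neg, not_false_eq_true]
    linarith [hm a a]
  · simp [skewMatrix, h]

/-- The conformal Killing field on `ℝⁿ` made of a translation `c`, a rotation `m`, a dilation `s`
and a special conformal transformation `β`. -/
def conformalField (c : Fin n → ℝ) (m : Fin n → Fin n → ℝ) (s : ℝ) (β : Fin n → ℝ)
    (x : Fin n → ℝ) (a : Fin n) : ℝ :=
  c a + (∑ b, m a b * x b) + s * x a + 2 * (∑ b, β b * x b) * x a - (∑ b, x b * x b) * β a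

/-- The zeroth-order coefficient that goes with `conformalField`. -/
def conformalWeight (β : Fin n → ℝ) (k : ℝ) (x : Fin n → ℝ) : ℝ :=
  ((n : ℝ) - 2) * (∑ b, β b * x b) + k

theorem contDiff_conformalField (c : Fin n → ℝ) (m : Fin n → Fin n → ℝ) (s : ℝ) (β : Fin n → ℝ) :
    ContDiff ℝ (⊤ : ℕ∞) (conformalField c m s β) := by
  unfold conformalField; fun_prop

theorem contDiff_conformalWeight (β : Fin n → ℝ) (k : ℝ) :
    ContDiff ℝ (⊤ : ℕ∞) (conformalWeight β k) := by
  unfold conformalWeight; fun_prop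

theorem differentiable_coord (b : Fin n) : Differentiable ℝ fun x : Fin n → ℝ => x b := by
  fun_prop

theorem pd_linear (m : Fin n → ℝ) (a : Fin n) : pd a (fun x => ∑ b, m b * x b) = fun _ => m a := by
  rw [pd_sum _ fun b => by fun_prop]
  funext x
  simp [fun b => pd_const_mul (differentiable_coord b), pd_coord]

theorem pd_normSq (a : Fin n) : pd a (fun x => ∑ b, x b * x b) = fun x => 2 * x a := by
  rw [pd_sum _ fun b => by fun_prop]
  funext x
  simp [fun b => pd_mul (differentiable_coord b) (differentiable_coord b), pd_coord,
    Finset.sum_add_distrib]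
  ring

theorem pd_conformalField (c : Fin n → ℝ) (m : Fin n → Fin n → ℝ) (s : ℝ) (β : Fin n → ℝ)
    (a b : Fin n) : pd b (fun x => conformalField c m s β x a) = fun x =>
      m a b + (if a = b then 1 else 0) * (s + 2 * ∑ d, β d * x d) + 2 * β b * x a -
        2 * β a * x b := by
  unfold conformalField
  rw [pd_sub (by fun_prop) (by fun_prop), pd_add (by fun_prop) (by fun_prop),
    pd_add (by fun_prop) (by fun_prop), pd_add (by fun_prop) (by fun_prop),
    pd_mul (by fun_prop) (by fun_prop), pd_mul (by fun_prop) (by fun_prop),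
    pd_mul (by fun_prop) (by fun_prop), pd_mul (by fun_prop) (by fun_prop)]
  simp only [pd_const, pd_coord, pd_linear, pd_normSq]
  funext x
  ring

theorem pd_pd_conformalField (c : Fin n → ℝ) (m : Fin n → Fin n → ℝ) (s : ℝ) (β : Fin n → ℝ)
    (a b d : Fin n) : pd d (pd b (fun x => conformalField c m s β x a)) = fun _ =>
      (if a = b then 1 else 0) * (2 * β d) + 2 * β b * (if a = d then 1 else 0) -
        2 * β a * (if b = d then 1 else 0) := by
  rw [pd_conformalField, pd_sub (by fun_prop) (by fun_prop), pd_add (by fun_prop) (by fun_prop),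
    pd_add (by fun_prop) (by fun_prop), pd_const_mul (by fun_prop), pd_const_mul (by fun_prop),
    pd_const_mul (by fun_prop), pd_add (by fun_prop) (by fun_prop), pd_const_mul (by fun_prop)]
  simp only [pd_const, pd_coord, pd_linear, zero_add]

theorem pd_conformalWeight (β : Fin n → ℝ) (k : ℝ) (a : Fin n) :
    pd a (conformalWeight β k) = fun _ => ((n : ℝ) - 2) * β a := by
  unfold conformalWeight
  rw [pd_add (by fun_prop) (by fun_prop), pd_const_mul (by fun_prop), pd_linear, pd_const]
  simp

theorem conformalSystem_conformalField (c : Fin n → ℝ) {m : Fin n → Fin n → ℝ}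
    (hm : ∀ a b, m a b + m b a = 0) (s : ℝ) (β : Fin n → ℝ) (k : ℝ) :
    ConformalSystem (conformalField c m s β) (conformalWeight β k) where
  lap_zeroth x := by simp [lap, pd_conformalWeight, pd_const]
  lap_field a x := by
    simp [lap, pd_conformalWeight, pd_pd_conformalField, Finset.sum_add_distrib]
    ring
  offDiag a b hab x := by
    simp only [pd_conformalField, hab, hab.symm, if_false]
    linarith [hm a b]
  diag a b x := by
    simp only [pd_conformalField, if_true]
    linarith [hm a a, hm b b]

theorem ConformalSystem.exists_eq (hn : 3 ≤ n) {V : (Fin n → ℝ) → Fin n → ℝ}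
    {u : (Fin n → ℝ) → ℝ} (hV : ∀ a, ContDiff ℝ (⊤ : ℕ∞) fun x => V x a)
    (hu : ContDiff ℝ (⊤ : ℕ∞) u) (hs : ConformalSystem V u) :
    ∃ c m s β k, (∀ a b, m a b + m b a = 0) ∧ conformalField c m s β = V ∧
      conformalWeight β k = u := by
  let o : Fin n := ⟨0, by omega⟩
  have hn' : (n : ℝ) - 2 ≠ 0 := by
    have : (3 : ℝ) ≤ n := by exact_mod_cast hn
    linarith
  obtain ⟨l, hl⟩ : ∃ l, l = pd o (fun x => V x o) := ⟨_, rfl⟩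
  have sl : ContDiff ℝ (⊤ : ℕ∞) l := hl ▸ contDiff_pd (hV o) o
  have dl := differentiable_of_smooth sl
  have spl := contDiff_pd sl
  have dpl := fun a => differentiable_of_smooth (spl a)
  have sV1 := fun a b => contDiff_pd (hV a) b
  have dV1 := fun a b => differentiable_of_smooth (sV1 a b)
  have killing : ∀ a b, pd a (fun x => V x b) =
      fun x => (if a = b then 2 else 0) * l x - pd b (fun x => V x a) x := by
    intro a b
    funext x
    split_ifs with hab
    · subst hab
      rw [hl, hs.diag o a]
      ring
    · linarith [hs.offDiag a b hab x]
  have second : ∀ c b a x, pd c (pd b fun x => V x a) x =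
      (if b = a then 1 else 0) * pd c l x + (if c = a then 1 else 0) * pd b l x -
        (if c = b then 1 else 0) * pd a l x := by
    have E : ∀ c a b x, pd c (pd a fun x => V x b) x + pd c (pd b fun x => V x a) x =
        2 * ((if a = b then 1 else 0) * pd c l x) := by
      intro c a b x
      rw [killing a b, pd_sub (by fun_prop) (dV1 _ _), pd_const_mul dl]
      split_ifs <;> ring
    have S : ∀ c a b x, pd c (pd a fun x => V x b) x = pd a (pd c fun x => V x b) x :=
      fun c a b x => by rw [pd_comm (hV b)]
    intro c b a x
    have e1 := E c b a x
    have e2 := E a c b x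
    have e3 := E b c a x
    linarith [S c b a x, S a c b x, S a b c x, S c a b x]
  have du : ∀ a, pd a u = fun x => ((n : ℝ) - 2) / 2 * pd a l x := by
    intro a
    funext x
    have h := hs.lap_field a x
    simp [lap, second, Finset.sum_add_distrib] at h
    linarith
  have trace : ∀ x, ∑ a, pd a (pd a l) x = 0 := by
    intro x
    have h := hs.lap_zeroth x
    simp only [lap, du, fun a => pd_const_mul (dpl a), ← Finset.mul_sum] at h
    exact (mul_eq_zero.1 h).resolve_left (div_ne_zero hn' two_ne_zero)
  have hess : ∀ d b x, pd d (pd b l) x = 0 := by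
    intro d b x
    have third : ∀ d c b a, pd d (pd c (pd b fun x => V x a)) x =
        (if b = a then 1 else 0) * pd d (pd c l) x + (if c = a then 1 else 0) * pd d (pd b l) x -
        (if c = b then 1 else 0) * pd d (pd a l) x := by
      intro d c b a
      rw [funext (second c b a), pd_sub (by fun_prop) (by fun_prop),
        pd_add (by fun_prop) (by fun_prop), pd_const_mul (dpl _), pd_const_mul (dpl _),
        pd_const_mul (dpl _)]
    have h : ∑ a, pd d (pd a (pd b fun x => V x a)) x =
        ∑ a, pd a (pd d (pd b fun x => V x a)) x :=
      Finset.sum_congr rfl fun a _ => by rw [pd_comm (sV1 a b)]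
    simp only [third, pd_comm sl _ d] at h
    simp [Finset.sum_add_distrib, trace] at h
    have : ((n : ℝ) - 2) * pd d (pd b l) x = 0 := by
      linarith
    exact (mul_eq_zero.1 this).resolve_left hn'
  have dlc : ∀ b x, pd b l x = pd b l 0 := fun b x =>
    eq_const_of_pd_eq_zero (dpl b) (fun d y => hess d b y) x
  let m : Fin n → Fin n → ℝ := fun a b => pd b (fun x => V x a) 0 - if a = b then l 0 else 0
  let c : Fin n → ℝ := V 0
  let β : Fin n → ℝ := fun b => pd b l 0 / 2
  refine ⟨c, m, l 0, β, u 0, fun a b => ?_, ?_, ?_⟩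
  · have := congrFun (killing a b) 0
    simp only [m, this]
    by_cases hab : a = b
    · subst hab; simp; ring
    · simp [hab, Ne.symm hab]
  · have sW := contDiff_conformalField c m (l 0) β
    have sWa : ∀ a, ContDiff ℝ (⊤ : ℕ∞) fun x => conformalField c m (l 0) β x a :=
      contDiff_pi.1 sW
    have first : ∀ a b, pd b (fun x => conformalField c m (l 0) β x a) =
        pd b fun x => V x a := by
      intro a b
      refine eq_of_pd_eq (differentiable_of_smooth (contDiff_pd (sWa a) b)) (dV1 a b)
        (fun d x => ?_) ?_
      · rw [pd_pd_conformalField, second, dlc d, dlc a, dlc b]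
        simp only [β, eq_comm]
        ring
      · rw [pd_conformalField]
        simp [m]
    have comp : ∀ a, (fun x => conformalField c m (l 0) β x a) = fun x => V x a := fun a =>
      eq_of_pd_eq (differentiable_of_smooth (sWa a)) (differentiable_of_smooth (hV a))
        (fun b x => by rw [first]) (by simp [conformalField, c])
    funext x a
    exact congrFun (comp a) x
  · refine eq_of_pd_eq (differentiable_of_smooth (contDiff_conformalWeight _ _))
      (differentiable_of_smooth hu) (fun a x => ?_) (by simp [conformalWeight])
    simp only [pd_conformalWeight, du, dlc a x, β]
    ring

/-- The parametrization of the first-order operators that preserve harmonicity. -/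
def conformalOperator (n : ℕ) :
    ((Fin n → ℝ) × ((Σ i : Fin n, Fin i) → ℝ) × ℝ × (Fin n → ℝ) × ℝ) →ₗ[ℝ]
      ((Fin n → ℝ) → (Fin n → ℝ)) × ((Fin n → ℝ) → ℝ) where
  toFun p := (conformalField p.1 (skewMatrix p.2.1) p.2.2.1 p.2.2.2.1,
    conformalWeight p.2.2.2.1 p.2.2.2.2)
  map_add' p q := by
    have hskew : ∀ a b, skewMatrix (p.2.1 + q.2.1) a b =
        skewMatrix p.2.1 a b + skewMatrix q.2.1 a b := fun a b => by
      unfold skewMatrix; split_ifs <;> simp; ring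
    ext x
    · simp only [conformalField, Prod.fst_add, Prod.snd_add, Pi.add_apply, hskew, add_mul,
        Finset.sum_add_distrib]
      ring
    · simp only [conformalWeight, Prod.fst_add, Prod.snd_add, Pi.add_apply, add_mul,
        Finset.sum_add_distrib]
      ring
  map_smul' r p := by
    have hskew : ∀ a b, skewMatrix (r • p.2.1) a b = r * skewMatrix p.2.1 a b := fun a b => by
      unfold skewMatrix; split_ifs <;> simp
    ext x
    · simp only [conformalField, Prod.smul_fst, Prod.smul_snd, Pi.smul_apply, hskew, mul_assoc,
        ← Finset.mul_sum, smul_eq_mul, RingHom.id_apply]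
      ring
    · simp only [conformalWeight, Prod.smul_fst, Prod.smul_snd, Pi.smul_apply, mul_assoc,
        ← Finset.mul_sum, smul_eq_mul, RingHom.id_apply]
      ring

theorem conformalOperator_injective (hn : 3 ≤ n) : Function.Injective (conformalOperator n) := by
  rw [← LinearMap.ker_eq_bot, LinearMap.ker_eq_bot']
  rintro ⟨c, μ, s, β, k⟩ h
  have hn' : (n : ℝ) - 2 ≠ 0 := by
    have : (3 : ℝ) ≤ n := by exact_mod_cast hn
    linarith
  have hF : conformalField c (skewMatrix μ) s β = 0 := congrArg Prod.fst h
  have hW : conformalWeight β k = fun _ => 0 := congrArg Prod.snd h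
  have hβ : ∀ a, β a = 0 := fun a => by
    have := congrFun (pd_conformalWeight β k a) 0
    rw [hW, pd_const] at this
    exact (mul_eq_zero.1 this.symm).resolve_left hn'
  have hk : k = 0 := by simpa [conformalWeight] using congrFun hW 0
  have hc : ∀ a, c a = 0 := fun a => by
    simpa [conformalField] using congrFun (congrFun hF 0) a
  have hm : ∀ a b, skewMatrix μ a b + (if a = b then s else 0) = 0 := fun a b => by
    have := congrFun (pd_conformalField c (skewMatrix μ) s β a b) 0
    rw [hF] at this
    simpa [pd_const] using this.symm
  have hs : s = 0 := by
    simpa [skewMatrix_self] using hm ⟨0, by omega⟩ ⟨0, by omega⟩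
  have hμ : μ = 0 := by
    funext ⟨i, j⟩
    have := hm i ⟨j, j.2.trans i.2⟩
    simpa [hs, skewMatrix, Fin.lt_def] using this
  simp [hk, hs, hμ, funext hc, funext hβ]
  rfl

theorem finrank_conformalParameters (n : ℕ) :
    Module.finrank ℝ ((Fin n → ℝ) × ((Σ i : Fin n, Fin i) → ℝ) × ℝ × (Fin n → ℝ) × ℝ) =
      (n ^ 2 + 3 * n + 4) / 2 := by
  have h : (∑ i : Fin n, (i : ℕ)) * 2 = n * (n - 1) := by
    rw [Fin.sum_univ_eq_sum_range (fun i => i), Finset.sum_range_id_mul_two]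
  simp only [Module.finrank_prod, Module.finrank_fintype_fun_eq_card, Fintype.card_sigma,
    Fintype.card_fin, Module.finrank_self]
  have h2 : n * (n - 1) + n = n ^ 2 := by
    cases n with
    | zero => rfl
    | succ k => simp; ring
  omega

end ConformalKilling

/-- The pairs `(V, u)` of a smooth vector field and a smooth function on ℝⁿ (n ≥ 3)
such that `f ↦ Σ_a V^a ∂_a f + u f` preserves harmonicity form a real vector subspace
of the space of such pairs, of dimension `(n² + 3n + 4)/2`. -/
theorem stmt_5 (n : ℕ) (hn : 3 ≤ n) :
    ∃ W : Submodule ℝ (((Fin n → ℝ) → (Fin n → ℝ)) × ((Fin n → ℝ) → ℝ)),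
      (∀ p : ((Fin n → ℝ) → (Fin n → ℝ)) × ((Fin n → ℝ) → ℝ),
        p ∈ W ↔ ContDiff ℝ (⊤ : ℕ∞) p.1 ∧ ContDiff ℝ (⊤ : ℕ∞) p.2 ∧
          ∀ f : (Fin n → ℝ) → ℝ, ContDiff ℝ (⊤ : ℕ∞) f → lap f = 0 →
            lap (fun x => (∑ a, p.1 x a * pd a f x) + p.2 x * f x) = 0) ∧
      Module.finrank ℝ W = (n ^ 2 + 3 * n + 4) / 2 := by
  refine ⟨LinearMap.range (conformalOperator n), ?_, ?_⟩
  · rintro ⟨V, u⟩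
    constructor
    · rintro ⟨⟨c, μ, s, β, k⟩, h⟩
      obtain ⟨rfl, rfl⟩ := Prod.mk.inj h
      have sV := contDiff_conformalField c (skewMatrix μ) s β
      have su := contDiff_conformalWeight β k
      exact ⟨sV, su, fun f hf h0 => ConformalSystem.preserves (contDiff_pi.1 sV) su
        (conformalSystem_conformalField c (skewMatrix_add_swap μ) s β k) hf h0⟩
    · rintro ⟨sV, su, H⟩
      have sVa := contDiff_pi.1 sV
      obtain ⟨c, m, s, β, k, hm, hV, hu⟩ :=
        (ConformalSystem.of_preserves sVa su H).exists_eq hn sVa su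
      refine ⟨⟨c, fun p => m p.1 ⟨p.2, p.2.2.trans p.1.2⟩, s, β, k⟩, ?_⟩
      exact Prod.ext (by simpa only [conformalOperator, LinearMap.coe_mk, AddHom.coe_mk,
        skewMatrix_of_skew hm] using hV) hu
  · rw [LinearMap.finrank_range_of_inj (conformalOperator_injective hn),
      finrank_conformalParameters]
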